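/- Let v, w, X, Y ∈ ℝ^d with v, w nonzero, ‖X‖ < ‖v‖ and ‖Y‖ < ‖w‖, and define h(v,w,X,Y) := −(‖X‖·‖Y‖)/(‖v‖·‖w‖) + √(1 − ‖X‖²/‖v‖²) · √(1 − ‖Y‖²/‖w‖²). If α(v,w) ≤ h(v,w,X,Y), then α(v+X, w+Y) ≤ α(v,w)·h(v,w,X,Y) + √(1 − α(v,w)²) · √(1 − h(v,w,X,Y)²). -/

import Mathlib

open RealInnerProductSpace

lemma aux_angle {d : ℕ} (v X : EuclideanSpace ℝ (Fin d)) (hv : v ≠ 0) (hX : ‖X‖ < ‖v‖) :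
    InnerProductGeometry.angle v (v + X) ≤ Real.arcsin (‖X‖ / ‖v‖) := by
  have hV : 0 < ‖v‖ := norm_pos_iff.mpr hv
  have hN : 0 < ‖v + X‖ := by
    rw [norm_pos_iff]
    intro h0
    have : X = -v := (neg_eq_of_add_eq_zero_right h0).symm
    rw [this, norm_neg] at hX
    exact lt_irrefl _ hX
  have hr0 : 0 ≤ ‖X‖ / ‖v‖ := by positivity
  have ha0 : 0 ≤ Real.arcsin (‖X‖ / ‖v‖) := Real.arcsin_nonneg.mpr hr0
  have ha1 := Real.arcsin_le_pi_div_two (‖X‖ / ‖v‖)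
  have hpi := Real.pi_pos
  refine (Real.strictAntiOn_cos.le_iff_ge ⟨ha0, by linarith⟩
    ⟨InnerProductGeometry.angle_nonneg _ _, InnerProductGeometry.angle_le_pi _ _⟩).mp ?_
  rw [Real.cos_arcsin, InnerProductGeometry.cos_angle, le_div_iff₀ (by positivity)]
  set q := Real.sqrt (1 - (‖X‖ / ‖v‖) ^ 2) with hq
  have hq2 : q ^ 2 = 1 - (‖X‖ / ‖v‖) ^ 2 := by
    apply Real.sq_sqrt
    have : ‖X‖ / ‖v‖ ≤ 1 := (div_le_one hV).mpr hX.le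
    nlinarith
  have hs : (q * ‖v‖) ^ 2 = ‖v‖ ^ 2 - ‖X‖ ^ 2 := by
    rw [mul_pow, hq2]; field_simp
  have hn := norm_add_sq_real v X
  rw [inner_add_right, real_inner_self_eq_norm_sq]
  nlinarith [sq_nonneg (q * ‖v‖ - ‖v + X‖)]

/-- Upper bound on the cosine similarity between noisy approximations of two
different vectors `v` and `w`. -/
theorem cosine_different_vectors_upper_bound (d : ℕ)
    (v w X Y : EuclideanSpace ℝ (Fin d))
    (hv : v ≠ 0) (hw : w ≠ 0)
    (hX : ‖X‖ < ‖v‖) (hY : ‖Y‖ < ‖w‖)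
    (h : ℝ)
    (hh : h = -(‖X‖ * ‖Y‖) / (‖v‖ * ‖w‖) +
      Real.sqrt (1 - ‖X‖ ^ 2 / ‖v‖ ^ 2) * Real.sqrt (1 - ‖Y‖ ^ 2 / ‖w‖ ^ 2))
    (hcond : ⟪v, w⟫ / (‖v‖ * ‖w‖) ≤ h) :
    ⟪v + X, w + Y⟫ / (‖v + X‖ * ‖w + Y‖) ≤
      (⟪v, w⟫ / (‖v‖ * ‖w‖)) * h +
        Real.sqrt (1 - (⟪v, w⟫ / (‖v‖ * ‖w‖)) ^ 2) * Real.sqrt (1 - h ^ 2) := by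
  have hV : 0 < ‖v‖ := norm_pos_iff.mpr hv
  have hW : 0 < ‖w‖ := norm_pos_iff.mpr hw
  have hA := aux_angle v X hv hX
  have hB := aux_angle w Y hw hY
  have hx0 : 0 ≤ ‖X‖ / ‖v‖ := by positivity
  have hy0 : 0 ≤ ‖Y‖ / ‖w‖ := by positivity
  have hx1 : ‖X‖ / ‖v‖ ≤ 1 := (div_le_one hV).mpr hX.le
  have hy1 : ‖Y‖ / ‖w‖ ≤ 1 := (div_le_one hW).mpr hY.le
  have ha0 := Real.arcsin_nonneg.mpr hx0
  have hb0 := Real.arcsin_nonneg.mpr hy0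
  have ha1 := Real.arcsin_le_pi_div_two (‖X‖ / ‖v‖)
  have hb1 := Real.arcsin_le_pi_div_two (‖Y‖ / ‖w‖)
  have hc : h = Real.cos (Real.arcsin (‖X‖ / ‖v‖) + Real.arcsin (‖Y‖ / ‖w‖)) := by
    rw [Real.cos_add, Real.cos_arcsin, Real.cos_arcsin, Real.sin_arcsin (by linarith) hx1,
      Real.sin_arcsin (by linarith) hy1, hh, div_pow, div_pow]
    field_simp
    ring
  set a := Real.arcsin (‖X‖ / ‖v‖)
  set b := Real.arcsin (‖Y‖ / ‖w‖)
  rw [← InnerProductGeometry.cos_angle, ← InnerProductGeometry.cos_angle] at *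
  have t1 := InnerProductGeometry.angle_le_angle_add_angle v (v + X) w
  have t2 := InnerProductGeometry.angle_le_angle_add_angle (v + X) (w + Y) w
  rw [InnerProductGeometry.angle_comm (w + Y) w] at t2
  have hθ0 := InnerProductGeometry.angle_nonneg v w
  have hθ1 := InnerProductGeometry.angle_le_pi v w
  have hφ1 := InnerProductGeometry.angle_le_pi (v + X) (w + Y)
  rw [hc] at hcond ⊢
  have hle := (Real.strictAntiOn_cos.le_iff_ge ⟨hθ0, hθ1⟩
    ⟨by linarith, by linarith⟩).mp hcond
  rw [← Real.sin_eq_sqrt_one_sub_cos_sq hθ0 hθ1,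
    ← Real.sin_eq_sqrt_one_sub_cos_sq (by linarith) (by linarith), ← Real.cos_sub]
  exact Real.cos_le_cos_of_nonneg_of_le_pi (by linarith) hφ1 (by linarith)
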